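/- Assume R_p < p^k for every prime p. Then for every ε > 0 there is a constant C (depending only on k, r, h_1,…,h_r, ε) such that for all Z ≥ 1: Σ_{Z < q ≤ 2Z} |G(q)| ≤ C·Z^{1/k − 1 + ε}. -/

import Mathlib

open scoped BigOperators Classical

noncomputable section

/-- `R_p`: the number of distinct residues of `h_1, …, h_r` modulo `p^k`. -/
def Rp (k r : ℕ) (h : Fin r → ℕ) (p : ℕ) : ℕ :=
  ((Finset.univ : Finset (Fin r)).image fun i => h i % p ^ k).card

/-- The multiplicative function `G`, with `G(p^l) = −p^{−k}/(1 − R_p·p^{−k})` for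
`1 ≤ l ≤ k` and `G(p^l) = 0` for `l > k`. -/
def Gfun (k r : ℕ) (h : Fin r → ℕ) (q : ℕ) : ℝ :=
  ∏ p ∈ q.primeFactors,
    (if q.factorization p ≤ k then
        -((p : ℝ) ^ k)⁻¹ / (1 - (Rp k r h p : ℝ) / (p : ℝ) ^ k)
      else 0)

theorem abs_inv_div_one_sub_le {R r x : ℝ} (hR : 0 ≤ R) (hRr : R ≤ r) (hx : R + 1 ≤ x) :
    |-x⁻¹ / (1 - R / x)| ≤ (r + 1) * x⁻¹ := by
  have hx0 : 0 < x := by linarith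
  have hxR : 0 < x - R := by linarith
  have heq : -x⁻¹ / (1 - R / x) = -(x - R)⁻¹ := by
    have : 1 - R / x = (x - R) / x := by field_simp
    rw [this]
    field_simp
  rw [heq, abs_neg, abs_of_pos (inv_pos.mpr hxR), inv_eq_one_div, ← div_eq_mul_inv,
    div_le_div_iff₀ hxR hx0]
  nlinarith [mul_nonneg hR (by linarith : (0 : ℝ) ≤ x - R - 1),
    mul_nonneg (sub_nonneg.mpr hRr) hxR.le]

theorem Rp_le (k r : ℕ) (h : Fin r → ℕ) (p : ℕ) : Rp k r h p ≤ r :=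
  Finset.card_image_le.trans (by simp)

theorem Gfun_one (k r : ℕ) (h : Fin r → ℕ) : Gfun k r h 1 = 1 := by
  simp [Gfun]

theorem Gfun_mul (k r : ℕ) (h : Fin r → ℕ) {m n : ℕ} (hmn : m.Coprime n) :
    Gfun k r h (m * n) = Gfun k r h m * Gfun k r h n := by
  unfold Gfun
  rw [hmn.primeFactors_mul, Finset.prod_union hmn.disjoint_primeFactors]
  congr 1
  · refine Finset.prod_congr rfl fun p hp => ?_
    rw [Nat.factorization_eq_of_coprime_left hmn
      (Nat.mem_primeFactors_iff_mem_primeFactorsList.mp hp)]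
  · refine Finset.prod_congr rfl fun p hp => ?_
    rw [Nat.factorization_eq_of_coprime_right hmn
      (Nat.mem_primeFactors_iff_mem_primeFactorsList.mp hp)]

theorem Gfun_prime_pow (k r : ℕ) (h : Fin r → ℕ) {p l : ℕ} (hp : p.Prime) (hl : l ≠ 0) :
    Gfun k r h (p ^ l) =
      if l ≤ k then -((p : ℝ) ^ k)⁻¹ / (1 - (Rp k r h p : ℝ) / (p : ℝ) ^ k) else 0 := by
  simp [Gfun, Nat.primeFactors_prime_pow hl hp, hp.factorization_self]

/-- The value of `Gfun` at a power of a prime `p` with `R_p < p^k` is `O(p^{-k})`, uniformly in `p`. -/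
theorem abs_Gfun_prime_pow_le {k r : ℕ} {h : Fin r → ℕ} {p l : ℕ} (hp : p.Prime)
    (hRp : Rp k r h p < p ^ k) (hl : l ≠ 0) :
    |Gfun k r h (p ^ l)| ≤ (r + 1) * ((p : ℝ) ^ k)⁻¹ := by
  rw [Gfun_prime_pow k r h hp hl]
  split_ifs
  · exact abs_inv_div_one_sub_le (by positivity) (by exact_mod_cast Rp_le k r h p)
      (by exact_mod_cast hRp)
  · rw [abs_zero]
    positivity

/-- A nonnegative multiplicative function supported on `(k+1)`-free integers has partial sums
bounded by an exponential of its size at prime powers. -/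
theorem sum_Icc_le_exp_of_multiplicative {f : ℕ → ℝ} {b : ℕ → ℝ} {k : ℕ} (hf : ∀ n, 0 ≤ f n)
    (hf₁ : f 1 = 1) (hmul : ∀ {m n : ℕ}, m.Coprime n → f (m * n) = f m * f n)
    (hle : ∀ p l : ℕ, p.Prime → l ≠ 0 → l ≤ k → f (p ^ l) ≤ b p)
    (hzero : ∀ p l : ℕ, p.Prime → k < l → f (p ^ l) = 0) (N : ℕ) :
    ∑ n ∈ Finset.Icc 1 N, f n ≤ Real.exp (∑ p ∈ (N + 1).primesBelow, k * b p) := by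
  have hvanish : ∀ {p : ℕ}, p.Prime → ∀ l ∉ Finset.range (k + 1), f (p ^ l) = 0 :=
    fun hp l hl => hzero _ l hp (by simpa using hl)
  have hsum : ∀ {p : ℕ}, p.Prime → Summable fun l : ℕ => ‖f (p ^ l)‖ := fun hp =>
    summable_of_ne_finset_zero (s := Finset.range (k + 1)) fun l hl => by
      rw [hvanish hp l hl, norm_zero]
  have hprod :=
    (EulerProduct.summable_and_hasSum_smoothNumbers_prod_primesBelow_tsum hf₁ hmul hsum (N + 1)).2
  have hmem : ∀ n ∈ Finset.Icc 1 N, n ∈ (N + 1).smoothNumbers := fun n hn => by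
    rw [Finset.mem_Icc] at hn
    exact Nat.mem_smoothNumbers_of_lt (by lia) (by lia)
  calc ∑ n ∈ Finset.Icc 1 N, f n
      = ∑ n ∈ (Finset.Icc 1 N).subtype (· ∈ (N + 1).smoothNumbers), f n :=
        (Finset.sum_subtype_of_mem f hmem).symm
    _ ≤ ∏ p ∈ (N + 1).primesBelow, ∑' l : ℕ, f (p ^ l) :=
        sum_le_hasSum _ (fun n _ => hf n) hprod
    _ ≤ ∏ p ∈ (N + 1).primesBelow, Real.exp (k * b p) := by
        refine Finset.prod_le_prod (fun p _ => tsum_nonneg fun l => hf _) fun p hp => ?_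
        have hp' := Nat.prime_of_mem_primesBelow hp
        rw [tsum_eq_sum (hvanish hp'), Finset.sum_range_succ', pow_zero, hf₁]
        refine le_trans ?_ (Real.add_one_le_exp _)
        gcongr
        calc ∑ l ∈ Finset.range k, f (p ^ (l + 1)) ≤ ∑ _l ∈ Finset.range k, b p :=
              Finset.sum_le_sum fun l hl =>
                hle p _ hp' l.succ_ne_zero (Finset.mem_range.mp hl)
          _ = k * b p := by simp
    _ = Real.exp (∑ p ∈ (N + 1).primesBelow, k * b p) := (Real.exp_sum _ _).symm

/-- Boundedness of the partial sums of `|G(n)| n^s` for `0 ≤ s` and `k s - k < -1`. -/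
theorem exists_sum_abs_Gfun_mul_rpow_le {k r : ℕ} {h : Fin r → ℕ}
    (hRp : ∀ p : ℕ, p.Prime → Rp k r h p < p ^ k) {s : ℝ} (hs : 0 ≤ s)
    (hks : k * s - k < -1) :
    ∃ C : ℝ, ∀ N : ℕ, ∑ n ∈ Finset.Icc 1 N, |Gfun k r h n| * (n : ℝ) ^ s ≤ C := by
  have hsumm : Summable fun n : ℕ => k * ((r + 1) * (n : ℝ) ^ (k * s - k : ℝ)) :=
    ((Real.summable_nat_rpow.mpr hks).mul_left _).mul_left _
  refine ⟨Real.exp (∑' n : ℕ, k * ((r + 1) * (n : ℝ) ^ (k * s - k : ℝ))), fun N => ?_⟩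
  refine (sum_Icc_le_exp_of_multiplicative (k := k)
    (b := fun n => (r + 1) * (n : ℝ) ^ (k * s - k : ℝ)) (fun n => by positivity)
    (by simp [Gfun_one]) (fun {m n} hmn => ?_) (fun p l hp hl hlk => ?_)
    (fun p l hp hkl => ?_) N).trans ?_
  · rw [Gfun_mul k r h hmn, abs_mul, Nat.cast_mul,
      Real.mul_rpow (Nat.cast_nonneg m) (Nat.cast_nonneg n)]
    ring
  · have hp1 : (1 : ℝ) ≤ p := by exact_mod_cast hp.one_le
    have hpow : ((p ^ l : ℕ) : ℝ) ^ s ≤ (p : ℝ) ^ (k * s : ℝ) := by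
      rw [Nat.cast_pow, ← Real.rpow_natCast, ← Real.rpow_mul (by linarith)]
      gcongr
    calc |Gfun k r h (p ^ l)| * ((p ^ l : ℕ) : ℝ) ^ s
        ≤ ((r + 1) * ((p : ℝ) ^ k)⁻¹) * (p : ℝ) ^ (k * s : ℝ) := by
          gcongr
          exact abs_Gfun_prime_pow_le hp (hRp p hp) hl
      _ = (r + 1) * (p : ℝ) ^ (k * s - k : ℝ) := by
          rw [Real.rpow_sub (by linarith), Real.rpow_natCast]
          ring
  · rw [Gfun_prime_pow k r h hp (by lia), if_neg (by lia), abs_zero, zero_mul]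
  · exact Real.exp_le_exp.mpr (hsumm.sum_le_tsum _ fun n _ => by positivity)

/-- `Σ_{Z < q ≤ 2Z} |G(q)| ≪_ε Z^{1/k − 1 + ε}`. -/
theorem stmt_10 (k r : ℕ) (hk : 2 ≤ k) (hr : 1 ≤ r) (h : Fin r → ℕ) (hh : StrictMono h)
    (hRp : ∀ p : ℕ, p.Prime → Rp k r h p < p ^ k) (ε : ℝ) (hε : 0 < ε) :
    ∃ C : ℝ, ∀ Z : ℝ, 1 ≤ Z →
      ∑ q ∈ Finset.Ioc ⌊Z⌋₊ ⌊2 * Z⌋₊, |Gfun k r h q|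
        ≤ C * Z ^ ((1:ℝ)/k - 1 + ε) := by
  have hk' : (2 : ℝ) ≤ k := by exact_mod_cast hk
  obtain ⟨s, hs0, hse, hks⟩ : ∃ s : ℝ, 0 ≤ s ∧ -s ≤ (1 : ℝ) / k - 1 + ε ∧ k * s - k < -1 := by
    refine ⟨max 0 (1 - 1 / k - ε), le_max_left _ _, ?_, ?_⟩
    · linarith [le_max_right (0 : ℝ) (1 - 1 / k - ε)]
    · rcases max_choice (0 : ℝ) (1 - 1 / k - ε) with hmax | hmax <;> rw [hmax]
      · linarith
      · have hkε : 0 < k * ε := by positivity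
        have hkk : (k : ℝ) * (1 / k) = 1 := by field_simp
        linarith
  obtain ⟨C, hC⟩ := exists_sum_abs_Gfun_mul_rpow_le hRp hs0 hks
  have hC0 : 0 ≤ C := by simpa using hC 0
  refine ⟨C, fun Z hZ => ?_⟩
  have hZ0 : 0 < Z := by linarith
  calc ∑ q ∈ Finset.Ioc ⌊Z⌋₊ ⌊2 * Z⌋₊, |Gfun k r h q|
      ≤ ∑ q ∈ Finset.Ioc ⌊Z⌋₊ ⌊2 * Z⌋₊, |Gfun k r h q| * (q : ℝ) ^ s * Z ^ (-s) := by
        refine Finset.sum_le_sum fun q hq => ?_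
        have hZq : Z ≤ q := (Nat.lt_of_floor_lt (Finset.mem_Ioc.mp hq).1).le
        have hone : 1 ≤ (q : ℝ) ^ s * Z ^ (-s) := by
          rw [Real.rpow_neg hZ0.le, ← div_eq_mul_inv, one_le_div (by positivity)]
          gcongr
        rw [mul_assoc]
        exact le_mul_of_one_le_right (abs_nonneg _) hone
    _ = (∑ q ∈ Finset.Ioc ⌊Z⌋₊ ⌊2 * Z⌋₊, |Gfun k r h q| * (q : ℝ) ^ s) * Z ^ (-s) :=
        (Finset.sum_mul _ _ _).symm
    _ ≤ C * Z ^ (-s) := by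
        gcongr
        refine le_trans (Finset.sum_le_sum_of_subset_of_nonneg (fun q hq => ?_)
          fun q _ _ => by positivity) (hC ⌊2 * Z⌋₊)
        rw [Finset.mem_Ioc] at hq
        rw [Finset.mem_Icc]
        exact ⟨by lia, hq.2⟩
    _ ≤ C * Z ^ ((1 : ℝ) / k - 1 + ε) := by
        gcongr
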